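/- arXiv:2508.12041 — 2 statements merged into one kernel-verified Lean document; each statement's English description precedes it below -/
import Mathlib

section
/- With notation as in the context (an algebra A over ℚ(q), an element B with its idivided powers B^{(m)}_{p̄} for parameter ς = −q^{−2}, an integer N ≥ 0, and a family (b_m) satisfying the stated recursion and vanishing), let M be a left A-module, p ∈ {0,1}, and v ∈ M such that for some K₀ one has B^{(k)}_{p̄} v = 0 for all k > K₀ and B^{(k)}_{(p+N) mod 2} (b₀ v) = 0 for all k > K₀. Then b_N · ( Σ_{k ≥ 0, k ≡ p (mod 2)} B^{(k)}_{p̄} v ) = Σ_{k ≥ 0, k ≡ p+N (mod 2)} B^{(k)}_{(p+N) mod 2} (b₀ v), where both sums have finitely many nonzero terms by hypothesis. -/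
noncomputable section

namespace SplitIdp

/-- The base field `F = ℚ(q)`. -/
abbrev F : Type := RatFunc ℚ

/-- `q^e` for `e : ℤ`. -/
def qz (e : ℤ) : F := (RatFunc.X : F) ^ e

/-- The quantum integer `[n]`. -/
def qint (n : ℤ) : F := (qz n - qz (-n)) / (qz 1 - qz (-1))

/-- The quantum factorial `[n]!`. -/
def qfact (n : ℕ) : F := ∏ i ∈ Finset.range n, qint ((i : ℤ) + 1)

/-- The balanced Gaussian binomial coefficient in the variable `q²`. -/
def qbinom2 (a : ℤ) (k : ℕ) : F :=
  ∏ s ∈ Finset.range k,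
    (qz (2 * (a - s)) - qz (-(2 * (a - s)))) /
      (qz (2 * ((s : ℤ) + 1)) - qz (-(2 * ((s : ℤ) + 1))))

variable {A : Type*} [Ring A] [Algebra F A]

/-- The idivided powers `B^{(m)}_{p̄}` of an element `B`, with parameter `ς = −q^{−2}`:
`B^{(0)}_{p̄} = 1`; for `m ≥ 1`,
`B^{(m)}_{0̄} = (1/[m]!)·B^{1+δ}·∏_{r=1}^{⌈m/2⌉−1}(B² + q^{−1}[2r]²)` (δ = 1 iff m even), and
`B^{(m)}_{1̄} = (1/[m]!)·B^{ε}·∏_{r=1}^{⌊m/2⌋}(B² + q^{−1}[2r−1]²)` (ε = 1 iff m odd);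
`B^{(m)}_{p̄} = 0` for `m < 0`. -/
def idp (B : A) (p : ZMod 2) (m : ℤ) : A :=
  if m < 0 then 0
  else if m = 0 then 1
  else if p = 0 then
    (qfact m.toNat)⁻¹ •
      (B ^ (if m % 2 = 0 then 2 else 1) *
        ((List.range ((m.toNat + 1) / 2 - 1)).map
            (fun r => B ^ 2 + (qz (-1) * qint (2 * ((r : ℤ) + 1)) ^ 2) • (1 : A))).prod)
  else
    (qfact m.toNat)⁻¹ •
      (B ^ (if m % 2 = 0 then 0 else 1) *
        ((List.range (m.toNat / 2)).map
            (fun r => B ^ 2 + (qz (-1) * qint (2 * ((r : ℤ) + 1) - 1) ^ 2) • (1 : A))).prod)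

end SplitIdp

open SplitIdp

namespace SplitIdp

lemma qz_ne_zero (a : ℤ) : qz a ≠ 0 := zpow_ne_zero _ RatFunc.X_ne_zero

lemma qz_add (a b : ℤ) : qz (a + b) = qz a * qz b := zpow_add₀ RatFunc.X_ne_zero a b

lemma qz_neg (a : ℤ) : qz (-a) = (qz a)⁻¹ := zpow_neg _ _

lemma qz_sub (a b : ℤ) : qz (a - b) = qz a / qz b := zpow_sub₀ RatFunc.X_ne_zero a b

@[simp] lemma qz_zero : qz 0 = 1 := zpow_zero _

lemma qz_injective : Function.Injective qz := by
  have key : ∀ n : ℕ, qz n = 1 → n = 0 := by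
    intro n h
    have h' : algebraMap (Polynomial ℚ) (RatFunc ℚ) (Polynomial.X ^ n) = algebraMap _ _ 1 := by
      simpa [qz] using h
    have h2 := congrArg Polynomial.natDegree (RatFunc.algebraMap_injective ℚ h')
    simpa using h2
  intro a b h
  have h0 : qz (a - b) = 1 := by rw [qz_sub, h, div_self (qz_ne_zero b)]
  obtain ⟨n, hn | hn⟩ := Int.eq_nat_or_neg (a - b)
  · have := key n (hn ▸ h0)
    lia
  · rw [hn, qz_neg, inv_eq_one] at h0
    have := key n h0
    lia

lemma qz_one_sub_ne_zero : qz 1 - qz (-1) ≠ 0 := by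
  intro h
  have := qz_injective (sub_eq_zero.mp h)
  lia

lemma qz_one_sq_sub_ne_zero : qz 1 ^ 2 - 1 ≠ 0 := by
  intro h
  apply qz_one_sub_ne_zero
  have := qz_ne_zero 1
  rw [qz_neg]
  field_simp
  simpa using h

lemma qint_eq (n : ℤ) : qint n = (qz n ^ 2 - 1) * qz 1 / (qz n * (qz 1 ^ 2 - 1)) := by
  have h1 := qz_ne_zero 1
  have h2 := qz_ne_zero n
  have h3 := qz_one_sq_sub_ne_zero
  have h4 := qz_one_sub_ne_zero
  rw [qint]
  rw [qz_neg] at h4 ⊢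
  rw [qz_neg]
  rw [div_eq_div_iff h4 (by positivity)]
  field_simp

lemma qint_injective : Function.Injective qint := by
  intro a b h
  rw [qint, qint, div_left_inj' qz_one_sub_ne_zero, qz_neg, qz_neg] at h
  have ha := qz_ne_zero a
  have hb := qz_ne_zero b
  have h' : (qz a - qz b) * (qz (a + b) + 1) = 0 := by
    rw [qz_add]
    field_simp at h
    linear_combination h
  rcases mul_eq_zero.mp h' with h' | h'
  · exact qz_injective (sub_eq_zero.mp h')
  · exfalso
    have h2 : qz ((a + b) + (a + b)) = qz 0 := by
      rw [qz_add, eq_neg_of_add_eq_zero_left h']; simp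
    have h3 := qz_injective h2
    have h4 : a + b = 0 := by lia
    rw [h4] at h'
    norm_num at h'

@[simp] lemma qint_zero : qint 0 = 0 := by simp [qint]

@[simp] lemma qint_one : qint 1 = 1 := div_self qz_one_sub_ne_zero

lemma qint_neg (n : ℤ) : qint (-n) = -qint n := by
  rw [qint, qint, neg_neg, ← neg_div, neg_sub]

lemma qint_ne_zero {n : ℤ} (hn : n ≠ 0) : qint n ≠ 0 :=
  fun h => hn (qint_injective (h.trans qint_zero.symm))

lemma qfact_zero : qfact 0 = 1 := rfl

lemma qfact_succ (n : ℕ) : qfact (n + 1) = qfact n * qint (n + 1) :=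
  Finset.prod_range_succ _ _

lemma qfact_ne_zero (n : ℕ) : qfact n ≠ 0 :=
  Finset.prod_ne_zero_iff.mpr fun _ _ => qint_ne_zero (by lia)

lemma qint_sub_mul_qint_add (a s : ℤ) :
    qint (a - s) * qint (a + s) = qint a ^ 2 - qint s ^ 2 := by
  have h1 := qz_ne_zero 1
  have h2 := qz_ne_zero a
  have h3 := qz_ne_zero s
  have h4 := qz_one_sq_sub_ne_zero
  simp only [qint_eq, qz_add, qz_sub]
  field_simp
  ring

lemma qint_add_one_sub (a : ℤ) : qint (a + 1) - qz 1 * qint a = qz (-a) := by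
  have h1 := qz_ne_zero 1
  have h2 := qz_ne_zero a
  have h4 := qz_one_sq_sub_ne_zero
  simp only [qint_eq, qz_add, qz_neg]
  field_simp
  ring

lemma qint_sub_one_sub (a : ℤ) : qint (a - 1) - qz 1 * qint a = -qz a := by
  have h1 := qz_ne_zero 1
  have h2 := qz_ne_zero a
  have h4 := qz_one_sq_sub_ne_zero
  simp only [qint_eq, qz_sub]
  field_simp
  ring

lemma qint_telescope (a k : ℤ) :
    qint (a + 1) * qint (a + k) - qz (-a) * qint (k + 1) * qint a
      = qz (k + 1) * qint (a - k) * qint (a + k) + qz k * qint k * qint (k + 1) := by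
  have h1 := qz_ne_zero 1
  have h2 := qz_ne_zero a
  have h3 := qz_ne_zero k
  have h4 := qz_one_sq_sub_ne_zero
  simp only [qint_eq, qz_add, qz_sub, qz_neg]
  field_simp
  ring

section RootPoly

variable {R S : Type*} [CommRing R] [Algebra F R] [CommRing S] [Algebra F S]

/-- The polynomial with roots `√(-q⁻¹)·[n-1-2i]` for `0 ≤ i < n`, evaluated at `y`. -/
def rootPoly (y : R) : ℕ → R
  | 0 => 1
  | 1 => y
  | n + 2 => rootPoly y n * (y ^ 2 + algebraMap F R (qz (-1) * qint (n + 1) ^ 2))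

lemma map_rootPoly (f : R →ₐ[F] S) (y : R) (n : ℕ) :
    f (rootPoly y n) = rootPoly (f y) n := by
  induction n using Nat.twoStepInduction with
  | zero => simp [rootPoly]
  | one => simp [rootPoly]
  | more n ih _ => simp only [rootPoly, map_mul, map_add, map_pow, ih, AlgHom.commutes]

lemma rootPoly_neg (y : R) (n : ℕ) : rootPoly (-y) n = (-1) ^ n * rootPoly y n := by
  induction n using Nat.twoStepInduction with
  | zero => simp [rootPoly]
  | one => simp [rootPoly]
  | more n ih _ => rw [rootPoly, rootPoly, ih]; ring

lemma rootPoly_even (y : R) (l : ℕ) :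
    rootPoly y (2 * l) = ((List.range l).map
      (fun r => y ^ 2 + (qz (-1) * qint (2 * ((r : ℤ) + 1) - 1) ^ 2) • (1 : R))).prod := by
  induction l with
  | zero => simp [rootPoly]
  | succ l ih =>
    simp only [bind_pure_comp, List.map_eq_map, List.range_succ, List.map_append,
      List.prod_append] at ih ⊢
    rw [← ih,
      show 2 * (l + 1) = 2 * l + 2 by ring, rootPoly]
    have : (2 * ((l : ℤ) + 1) - 1) = ((2 * l : ℕ) : ℤ) + 1 := by push_cast; ring
    simp [this, Algebra.smul_def]

lemma rootPoly_odd (y : R) (l : ℕ) :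
    rootPoly y (2 * l + 1) = y * ((List.range l).map
      (fun r => y ^ 2 + (qz (-1) * qint (2 * ((r : ℤ) + 1)) ^ 2) • (1 : R))).prod := by
  induction l with
  | zero => simp [rootPoly]
  | succ l ih =>
    simp only [bind_pure_comp, List.map_eq_map, List.range_succ, List.map_append,
      List.prod_append] at ih ⊢
    rw [← mul_assoc, ← ih,
      show 2 * (l + 1) + 1 = (2 * l + 1) + 2 by ring, rootPoly]
    have : (2 * ((l : ℤ) + 1)) = ((2 * l + 1 : ℕ) : ℤ) + 1 := by push_cast; ring
    simp [this, Algebra.smul_def]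

lemma map_idp {A A' : Type*} [Ring A] [Algebra F A] [Ring A'] [Algebra F A'] (f : A →ₐ[F] A')
    (y : A) (p : ZMod 2) (m : ℤ) : f (idp y p m) = idp (f y) p m := by
  unfold idp
  split_ifs <;> simp [map_list_prod, Function.comp_def]

lemma idp_zero {A : Type*} [Ring A] [Algebra F A] (y : A) (p : ZMod 2) : idp y p 0 = 1 := by
  simp [idp]

lemma natCast_zmod_two_cases {p : ZMod 2} {k : ℕ} (hk : (k : ZMod 2) = p) :
    (p = 0 ∧ ∃ l, k = 2 * l) ∨ (p = 1 ∧ ∃ l, k = 2 * l + 1) := by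
  subst hk
  rcases Nat.even_or_odd k with h | h
  · obtain ⟨l, rfl⟩ := h.exists_two_nsmul
    exact .inl ⟨by rw [ZMod.natCast_eq_zero_iff]; simp, l, by simp⟩
  · obtain ⟨l, rfl⟩ := h
    refine .inr ⟨?_, l, rfl⟩
    have : ((2 : ℕ) : ZMod 2) = 0 := ZMod.natCast_self 2
    push_cast at this ⊢
    simp [this]

lemma idp_succ_of_eq (y : R) {p : ZMod 2} {k : ℕ} (hk : (k : ZMod 2) = p) :
    idp y p ((k + 1 : ℕ) : ℤ) = (qfact (k + 1))⁻¹ • rootPoly y (k + 1) := by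
  rcases natCast_zmod_two_cases hk with ⟨rfl, l, rfl⟩ | ⟨rfl, l, rfl⟩
  · rw [rootPoly_odd, idp, if_neg (by lia), if_neg (by lia), if_pos rfl, if_neg (by lia),
      Int.toNat_natCast, show (2 * l + 1 + 1) / 2 - 1 = l by lia, pow_one]
  · rw [show 2 * l + 1 + 1 = 2 * (l + 1) by ring, rootPoly_even, idp, if_neg (by lia),
      if_neg (by lia), if_neg (by decide), if_pos (by lia),
      Int.toNat_natCast, show 2 * (l + 1) / 2 = l + 1 by lia, pow_zero, one_mul]

lemma idp_succ_of_ne (y : R) {p : ZMod 2} {k : ℕ} (hk : ((k + 1 : ℕ) : ZMod 2) = p) :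
    idp y p ((k + 1 : ℕ) : ℤ) = (qfact (k + 1))⁻¹ • (y * rootPoly y k) := by
  rcases natCast_zmod_two_cases hk with ⟨rfl, l, hl⟩ | ⟨rfl, l, hl⟩
  · obtain ⟨l, rfl⟩ : ∃ m, l = m + 1 := ⟨l - 1, by lia⟩
    obtain rfl : k = 2 * l + 1 := by lia
    rw [rootPoly_odd, idp, if_neg (by lia), if_neg (by lia), if_pos rfl, if_pos (by lia),
      Int.toNat_natCast, show (2 * l + 1 + 1 + 1) / 2 - 1 = l by lia, sq y, mul_assoc]
  · obtain rfl : k = 2 * l := by lia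
    rw [rootPoly_even, idp, if_neg (by lia),
      if_neg (by lia), if_neg (by decide), if_neg (by lia),
      Int.toNat_natCast, show (2 * l + 1) / 2 = l by lia, pow_one]

/-- The sum over `j ≤ k` with `j ≡ k (mod 2)` of the idivided powers of `y` of degree `j` and
parity `k`. -/
def idpSum (y : R) : ℕ → R
  | 0 => 1
  | 1 => y
  | k + 2 => idpSum y k + (qfact (k + 2))⁻¹ • (y * rootPoly y (k + 1))

lemma map_idpSum (f : R →ₐ[F] S) (y : R) (k : ℕ) : f (idpSum y k) = idpSum (f y) k := by
  induction k using Nat.twoStepInduction with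
  | zero => simp [idpSum]
  | one => simp [idpSum]
  | more n ih _ => simp only [idpSum, map_mul, map_add, map_smul, ih, map_rootPoly]

lemma idpSum_neg (y : R) (k : ℕ) : idpSum (-y) k = (-1) ^ k * idpSum y k := by
  induction k using Nat.twoStepInduction with
  | zero => simp [idpSum]
  | one => simp [idpSum]
  | more n ih _ =>
    rw [idpSum, idpSum, ih, rootPoly_neg, Algebra.smul_def, Algebra.smul_def]; ring

lemma sum_idp_eq_idpSum (y : R) {p : ZMod 2} {k : ℕ} (hk : (k : ZMod 2) = p) :
    ∑ j ∈ Finset.range (k + 1), (if (j : ZMod 2) = p then idp y p (j : ℤ) else 0)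
      = idpSum y k := by
  subst hk
  induction k using Nat.twoStepInduction with
  | zero => simp [idpSum, idp_zero]
  | one =>
    have := idp_succ_of_ne y (p := 1) (k := 0) (by simp)
    simp [Finset.sum_range_succ, qfact_succ, qfact_zero, rootPoly] at this ⊢
    simpa [idpSum] using this
  | more k ih _ =>
    have h2 : ((k + 2 : ℕ) : ZMod 2) = k := by
      rw [Nat.cast_add, ZMod.natCast_self, add_zero]
    have h1 : ((k + 1 : ℕ) : ZMod 2) ≠ k := by simp
    rw [Finset.sum_range_succ, Finset.sum_range_succ, h2, ih, if_neg h1, if_pos rfl, add_zero,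
      idpSum,
      idp_succ_of_ne y h2]

end RootPoly

section Eigenvalues

variable {K : Type*} [CommRing K] [Algebra F K]

/-- The scalar `c·[n]`; for `c² = -q⁻¹` these are the roots of the idivided powers. -/
def eigval (c : K) (n : ℤ) : K := c * algebraMap F K (qint n)

lemma eigval_neg (c : K) (n : ℤ) : eigval c (-n) = -eigval c n := by
  simp [eigval, qint_neg]

lemma rootPoly_eq_prod {c : K} (hc : c ^ 2 = -algebraMap F K (qz (-1))) (y : K) (n : ℕ) :
    rootPoly y n = ∏ i ∈ Finset.range n, (y - eigval c ((n : ℤ) - 1 - 2 * i)) := by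
  induction n using Nat.twoStepInduction with
  | zero => simp [rootPoly]
  | one => simp [rootPoly, eigval]
  | more n ih _ =>
    rw [rootPoly, ih, Finset.prod_range_succ, Finset.prod_range_succ']
    have h1 : ((n + 2 : ℕ) : ℤ) - 1 - 2 * ((n + 1 : ℕ) : ℤ) = -((n : ℤ) + 1) := by
      push_cast; ring
    have h2 : ((n + 2 : ℕ) : ℤ) - 1 - 2 * ((0 : ℕ) : ℤ) = (n : ℤ) + 1 := by
      push_cast; ring
    have h3 : ∀ i : ℕ, ((n + 2 : ℕ) : ℤ) - 1 - 2 * ((i + 1 : ℕ) : ℤ) = (n : ℤ) - 1 - 2 * i := by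
      intro i; push_cast; ring
    simp only [h1, h2, h3, eigval_neg]
    rw [mul_assoc]
    congr 1
    simp only [eigval, map_mul, map_pow]
    linear_combination algebraMap F K (qint (n + 1)) ^ 2 * hc

lemma rootPoly_eigval_eq_zero {c : K} (hc : c ^ 2 = -algebraMap F K (qz (-1))) {k i : ℕ}
    (hi : i ≤ k) : rootPoly (eigval c ((k : ℤ) - 2 * i)) (k + 1) = 0 := by
  rw [rootPoly_eq_prod hc]
  refine Finset.prod_eq_zero (Finset.mem_range.mpr (Nat.lt_succ_of_le hi)) ?_
  rw [sub_eq_zero]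
  push_cast
  congr 1
  ring

lemma eigval_sq_add {c : K} (hc : c ^ 2 = -algebraMap F K (qz (-1))) (a s : ℤ) :
    eigval c a ^ 2 + algebraMap F K (qz (-1) * qint s ^ 2)
      = c ^ 2 * algebraMap F K (qint (a - s) * qint (a + s)) := by
  rw [qint_sub_mul_qint_add, eigval]
  simp only [map_mul, map_sub, map_pow]
  linear_combination algebraMap F K (qint s) ^ 2 * hc

lemma rootPoly_eigval_add_one {c : K} (hc : c ^ 2 = -algebraMap F K (qz (-1))) (a : ℤ) (k : ℕ) :
    rootPoly (eigval c (a + 1)) (k + 1) = rootPoly (eigval c a) k * eigval c (a + k + 1) := by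
  induction k using Nat.twoStepInduction with
  | zero => simp [rootPoly]
  | one =>
    rw [rootPoly, rootPoly, rootPoly, eigval_sq_add hc]
    simp only [eigval, map_mul, Nat.cast_zero, Nat.cast_one, zero_add, one_mul,
      add_sub_cancel_right]
    ring
  | more k ih _ =>
    rw [rootPoly, ih, rootPoly, eigval_sq_add hc, eigval_sq_add hc]
    simp only [eigval, map_mul]
    have h1 : a + 1 - (((k + 1 : ℕ) : ℤ) + 1) = a - (k + 1) := by push_cast; ring
    have h2 : a + 1 + (((k + 1 : ℕ) : ℤ) + 1) = a + ((k + 2 : ℕ) : ℤ) + 1 := by push_cast; ring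
    have h3 : a + (k : ℤ) + 1 = a + (k + 1) := by ring
    rw [h1, h2, h3]
    ring

lemma idpSum_telescope {c : K} (hc : c ^ 2 = -algebraMap F K (qz (-1))) (a : ℤ) (k : ℕ) :
    idpSum (eigval c (a + 1)) (k + 1)
      = c * algebraMap F K (qz (-a)) * idpSum (eigval c a) k
        + algebraMap F K (qz (k + 1) * (qfact (k + 1))⁻¹) * rootPoly (eigval c a) (k + 1) := by
  have hq : c ^ 2 * algebraMap F K (qz 1) = -1 := by
    rw [hc, neg_mul, ← map_mul, ← qz_add]; simp
  induction k using Nat.twoStepInduction with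
  | zero =>
    have h := congrArg (algebraMap F K) (qint_add_one_sub a)
    simp [idpSum, rootPoly, eigval, qfact_succ, qfact_zero] at h ⊢
    linear_combination c * h
  | one =>
    have h := congrArg (algebraMap F K) (qint_telescope a 1)
    have h2 : algebraMap F K (qfact 2)⁻¹ * algebraMap F K (qint 2) = 1 := by
      rw [← map_mul, ← map_one (algebraMap F K)]
      congr 1
      have := qint_ne_zero (n := 2) (by lia)
      simp [qfact_succ, qfact_zero, this]
    rw [idpSum, idpSum, idpSum, rootPoly, rootPoly, rootPoly, eigval_sq_add hc, Algebra.smul_def]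
    simp only [eigval, map_mul, map_sub, map_add, qint_one, Nat.cast_zero, Nat.cast_one,
      zero_add, one_mul, mul_one, one_add_one_eq_two] at h ⊢
    linear_combination (c ^ 2 * algebraMap F K (qfact 2)⁻¹) * h
      + c ^ 2 * (algebraMap F K (qz (-a)) * algebraMap F K (qint a)
        + algebraMap F K (qz 1)) * h2 + hq
  | more k ih _ =>
    have h := congrArg (algebraMap F K) (qint_telescope a (k + 2))
    have e1 : (qfact (k + 2))⁻¹ = (qfact (k + 3))⁻¹ * qint (k + 3) := by
      have := qint_ne_zero (n := k + 3) (by lia)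
      rw [qfact_succ (k + 2)]
      push_cast
      rw [show (k : ℤ) + 2 + 1 = k + 3 by ring]
      field_simp
    have e2 : (qfact (k + 1))⁻¹ = (qfact (k + 2))⁻¹ * qint (k + 2) := by
      have := qint_ne_zero (n := k + 2) (by lia)
      rw [qfact_succ (k + 1)]
      push_cast
      rw [show (k : ℤ) + 1 + 1 = k + 2 by ring]
      field_simp
    have e3 : qz (k + 2) = qz (k + 1) * qz 1 := by rw [← qz_add]; congr 1
    have s1 : a - (((k + 1 : ℕ) : ℤ) + 1) = a - (k + 2) := by push_cast; ring
    have s2 : a + (((k + 1 : ℕ) : ℤ) + 1) = a + (k + 2) := by push_cast; ring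
    have s3 : a + ((k + 1 : ℕ) : ℤ) + 1 = a + (k + 2) := by push_cast; ring
    have s4 : ((k + 2 : ℕ) : ℤ) + 1 = k + 3 := by push_cast; ring
    have s5 : (k : ℤ) + 2 + 1 = k + 3 := by ring
    rw [idpSum, idpSum, ih, rootPoly_eigval_add_one hc, rootPoly, eigval_sq_add hc, s1, s2, s3,
      s4, e2, e1, Algebra.smul_def, Algebra.smul_def]
    rw [s5, e3] at h
    simp only [eigval, map_mul, map_sub, map_add] at h ⊢
    linear_combination (c ^ 2 * algebraMap F K (qfact (k + 3))⁻¹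
      * rootPoly (c * algebraMap F K (qint a)) (k + 1)) * h + (algebraMap F K (qfact (k + 3))⁻¹
      * rootPoly (c * algebraMap F K (qint a)) (k + 1) * algebraMap F K (qz (k + 1))
      * algebraMap F K (qint (k + 2)) * algebraMap F K (qint (k + 3))) * hq

lemma idpSum_eigval_add_one {c : K} (hc : c ^ 2 = -algebraMap F K (qz (-1))) {k i : ℕ}
    (hi : i ≤ k) :
    idpSum (eigval c ((k : ℤ) - 2 * i + 1)) (k + 1)
      = c * algebraMap F K (qz (-((k : ℤ) - 2 * i))) * idpSum (eigval c ((k : ℤ) - 2 * i)) k := by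
  rw [idpSum_telescope hc, rootPoly_eigval_eq_zero hc hi, mul_zero, add_zero]

lemma idpSum_eigval_sub_one {c : K} (hc : c ^ 2 = -algebraMap F K (qz (-1))) {k i : ℕ}
    (hi : i ≤ k) :
    idpSum (eigval c ((k : ℤ) - 2 * i - 1)) (k + 1)
      = -c * algebraMap F K (qz ((k : ℤ) - 2 * i)) * idpSum (eigval c ((k : ℤ) - 2 * i)) k := by
  have h := idpSum_eigval_add_one hc (Nat.sub_le k i)
  have h1 : (k : ℤ) - 2 * ((k - i : ℕ) : ℤ) = -((k : ℤ) - 2 * i) := by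
    rw [Nat.cast_sub hi]; ring
  rw [h1, show -((k : ℤ) - 2 * i) + 1 = -((k : ℤ) - 2 * i - 1) by ring, eigval_neg, eigval_neg,
    idpSum_neg, idpSum_neg, neg_neg] at h
  have h2 : ((-1 : K) ^ k) * (-1) ^ k = 1 := by rw [← mul_pow]; simp
  rw [pow_succ] at h
  linear_combination -(-1) ^ k * h + (-idpSum (eigval c ((k : ℤ) - 2 * i - 1)) (k + 1)
    - c * algebraMap F K (qz ((k : ℤ) - 2 * i)) * idpSum (eigval c ((k : ℤ) - 2 * i)) k) * h2

end Eigenvalues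

section SerrePoly

variable {R S : Type*} [CommRing R] [Algebra F R] [CommRing S] [Algebra F S]

/-- The polynomial in two commuting variables `l`, `r` which, when `l` and `r` act by left and
right multiplication by `B`, maps `b 0` to `[m]! • b m`. -/
def serrePoly (N : ℕ) (l r : R) : ℕ → R
  | 0 => 1
  | 1 => l - algebraMap F R (qz N) * r
  | m + 2 => (l - algebraMap F R (qz (N - 2 * (m + 1))) * r) * serrePoly N l r (m + 1)
      - algebraMap F R (qint (m + 1) * qint (m - N) * qz (N - 2 * (m + 1))) * serrePoly N l r m

lemma map_serrePoly (f : R →ₐ[F] S) (N : ℕ) (l r : R) (m : ℕ) :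
    f (serrePoly N l r m) = serrePoly N (f l) (f r) m := by
  induction m using Nat.twoStepInduction with
  | zero => simp [serrePoly]
  | one => simp [serrePoly]
  | more n ih ih' => simp only [serrePoly, map_mul, map_sub, ih, ih', AlgHom.commutes]

lemma serrePoly_succ (N : ℕ) (l r : R) (m : ℕ) :
    serrePoly N l r (m + 1) = (l - algebraMap F R (qz (N - 2 * m)) * r) * serrePoly N l r m
      - algebraMap F R (qint m * qint (m - 1 - N) * qz (N - 2 * m)) * serrePoly N l r (m - 1) := by
  cases m with
  | zero => simp [serrePoly]
  | succ m => simp [serrePoly]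

lemma serrePoly_add_two_top (N : ℕ) (l r : R) (h : serrePoly N l r (N + 1) = 0) :
    serrePoly N l r (N + 2) = 0 := by
  rw [serrePoly, h]; simp

lemma serrePoly_succ_left {N : ℕ} {l r s : R}
    (h : (s - algebraMap F R (qz 1) * r) * (algebraMap F R (qz 1) * s - r) = -1) (m : ℕ) :
    serrePoly (N + 1) l r m = serrePoly N l s m
      + algebraMap F R (qint m * qz (N + 1 - m)) * (s - algebraMap F R (qz 1) * r)
        * serrePoly N l s (m - 1) := by
  induction m using Nat.twoStepInduction with
  | zero => simp [serrePoly]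
  | one =>
    simp [serrePoly, qz_add]
    ring
  | more m ih ih' =>
    have hr := serrePoly_succ N l s m
    rw [serrePoly, ih, ih', serrePoly, show m + 2 - 1 = m + 1 from rfl, Nat.add_sub_cancel]
    simp only [Nat.cast_add, Nat.cast_one, Nat.cast_ofNat]
    have p1 : qz ((N : ℤ) - 2 * (m + 1)) = qz (N - m - 1) * qz (-(m + 1)) := by
      rw [← qz_add]; congr 1; ring
    have p2 : qz ((N : ℤ) + 1 - 2 * (m + 1)) = qz (N - 2 * (m + 1)) * qz 1 := by
      rw [← qz_add]; congr 1; ring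
    have p3 : qz ((N : ℤ) - 2 * m) = qz (N - 2 * (m + 1)) * (qz 1 * qz 1) := by
      rw [← qz_add, ← qz_add]; congr 1; ring
    have p4 : qz ((N : ℤ) + 1 - (m + 1)) = qz (N - m - 1) * qz 1 := by
      rw [← qz_add]; congr 1; ring
    have p5 : qz ((N : ℤ) + 1 - m) = qz (N - m - 1) * (qz 1 * qz 1) := by
      rw [← qz_add, ← qz_add]; congr 1; ring
    have p6 : qz ((N : ℤ) + 1 - (m + 2)) = qz (N - m - 1) := by
      congr 1; ring
    have p7 : qint ((m : ℤ) + 2) = qz 1 * qint (m + 1) + qz (-(m + 1)) := by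
      rw [← qint_add_one_sub ((m : ℤ) + 1), show (m : ℤ) + 1 + 1 = m + 2 by ring]; ring
    have p8 : qint ((m : ℤ) - N) = qz 1 * qint (m - 1 - N) + qz (N - m - 1) * (qz 1 * qz 1) := by
      have := qint_add_one_sub ((m : ℤ) - 1 - N)
      rw [show (m : ℤ) - 1 - N + 1 = m - N by ring,
        show -((m : ℤ) - 1 - N) = N + 1 - m by ring, p5] at this
      linear_combination this
    have p9 : (m : ℤ) - (N + 1) = m - 1 - N := by ring
    rw [p3] at hr
    rw [p9, p2, p4, p5, p6, p7, p8]
    rw [p1] at hr ⊢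
    simp only [map_mul, map_add] at hr ⊢
    set q := algebraMap F R (qz 1)
    set z := algebraMap F R (qz (N - m - 1))
    set w := algebraMap F R (qz (-(m + 1)))
    set a := algebraMap F R (qint (m + 1))
    linear_combination (-a * z * q * (s - q * r)) * hr
      + a * (z * w) * z * q ^ 2 * serrePoly N l s m * h

theorem serrePoly_eigval {K : Type*} [CommRing K] [Algebra F K] {c : K}
    (hc : c ^ 2 = -algebraMap F K (qz (-1))) {N k i j : ℕ} (hi : i ≤ k) (hj : j ≤ N) :
    serrePoly N (eigval c ((k + N : ℕ) - 2 * (i + j : ℕ))) (eigval c (k - 2 * i)) (N + 1) = 0 ∧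
      algebraMap F K (qfact N) * idpSum (eigval c ((k + N : ℕ) - 2 * (i + j : ℕ))) (k + N)
        = serrePoly N (eigval c ((k + N : ℕ) - 2 * (i + j : ℕ))) (eigval c (k - 2 * i)) N
          * idpSum (eigval c (k - 2 * i)) k := by
  have hq : ∀ a b : ℤ, a + b = 1 →
      c ^ 2 * algebraMap F K (qz a) * algebraMap F K (qz b) = -1 := by
    intro a b hab
    rw [hc, mul_assoc, ← map_mul, ← qz_add, hab, neg_mul, ← map_mul, ← qz_add]
    simp
  induction N generalizing k i j with
  | zero =>
    obtain rfl : j = 0 := by lia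
    simp [serrePoly, qfact_zero]
  | succ N ih =>
    have key : ∀ i' j' : ℕ, i' ≤ k + 1 → j' ≤ N → i' + j' = i + j →
        ∀ x : K, x = eigval c ((k + 1 : ℕ) - 2 * i')
          - algebraMap F K (qz 1) * eigval c (k - 2 * i) →
        x * (algebraMap F K (qz 1) * eigval c ((k + 1 : ℕ) - 2 * i')
          - eigval c (k - 2 * i)) = -1 →
        idpSum (eigval c ((k + 1 : ℕ) - 2 * i')) (k + 1) = x * idpSum (eigval c (k - 2 * i)) k →
        serrePoly (N + 1) (eigval c ((k + (N + 1) : ℕ) - 2 * (i + j : ℕ))) (eigval c (k - 2 * i))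
          (N + 1 + 1) = 0 ∧
        algebraMap F K (qfact (N + 1))
            * idpSum (eigval c ((k + (N + 1) : ℕ) - 2 * (i + j : ℕ))) (k + (N + 1))
          = serrePoly (N + 1) (eigval c ((k + (N + 1) : ℕ) - 2 * (i + j : ℕ)))
              (eigval c (k - 2 * i)) (N + 1) * idpSum (eigval c (k - 2 * i)) k := by
      intro i' j' hi' hj' hij x hx h h'
      obtain ⟨h0, h1⟩ := ih hi' hj'
      rw [hij, show k + 1 + N = k + (N + 1) by ring] at h0 h1
      subst hx
      constructor
      · rw [serrePoly_succ_left h, serrePoly_add_two_top _ _ _ h0, Nat.add_sub_cancel, h0]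
        simp
      · rw [serrePoly_succ_left h, h0, qfact_succ, Nat.add_sub_cancel]
        rw [h'] at h1
        simp only [Nat.cast_add, Nat.cast_one, sub_self, qz_zero, mul_one, zero_add, map_mul]
          at h1 ⊢
        linear_combination algebraMap F K (qint (N + 1)) * h1
    rcases Nat.lt_or_ge N j with hlt | hle
    · obtain rfl : j = N + 1 := by lia
      have e : ((k + 1 : ℕ) : ℤ) - 2 * ((i + 1 : ℕ) : ℤ) = (k : ℤ) - 2 * i - 1 := by
        push_cast; ring
      have a1 := congrArg (algebraMap F K) (qint_sub_one_sub ((k : ℤ) - 2 * i))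
      have a2 := congrArg (algebraMap F K) (qint_add_one_sub ((k : ℤ) - 2 * i - 1))
      refine key (i + 1) N (by lia) le_rfl (by lia)
        (-c * algebraMap F K (qz ((k : ℤ) - 2 * i))) ?_ ?_ ?_
      · rw [e]
        simp only [map_sub, map_mul, map_neg] at a1
        simp only [eigval]
        linear_combination -c * a1
      · simp only [map_sub, map_mul] at a2
        rw [show (k : ℤ) - 2 * i - 1 + 1 = k - 2 * i by ring] at a2
        rw [e]
        simp only [eigval]
        have a3 := hq ((k : ℤ) - 2 * i) (-((k : ℤ) - 2 * i - 1)) (by ring)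
        linear_combination c ^ 2 * algebraMap F K (qz ((k : ℤ) - 2 * i)) * a2 + a3
      · rw [e, idpSum_eigval_sub_one hc hi]
    · have e : ((k + 1 : ℕ) : ℤ) - 2 * (i : ℤ) = (k : ℤ) - 2 * i + 1 := by
        push_cast; ring
      have a1 := congrArg (algebraMap F K) (qint_add_one_sub ((k : ℤ) - 2 * i))
      have a2 := congrArg (algebraMap F K) (qint_sub_one_sub ((k : ℤ) - 2 * i + 1))
      refine key i j (by lia) hle rfl
        (c * algebraMap F K (qz (-((k : ℤ) - 2 * i)))) ?_ ?_ ?_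
      · rw [e]
        simp only [map_sub, map_mul] at a1
        simp only [eigval]
        linear_combination -c * a1
      · simp only [map_sub, map_mul, map_neg] at a2
        rw [add_sub_cancel_right] at a2
        rw [e]
        simp only [eigval]
        have a3 := hq (-((k : ℤ) - 2 * i)) ((k : ℤ) - 2 * i + 1) (by ring)
        linear_combination -c ^ 2 * algebraMap F K (qz (-((k : ℤ) - 2 * i))) * a2 + a3
      · rw [e, idpSum_eigval_add_one hc hi]

end SerrePoly

section Ideal

open Polynomial

lemma monic_serrePoly (N m : ℕ) :
    (serrePoly N (X : F[X][X]) (C X) m).Monic ∧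
      (serrePoly N (X : F[X][X]) (C X) m).natDegree = m := by
  have hC : ∀ t : F, algebraMap F F[X][X] t = C (C t) := fun t => rfl
  induction m using Nat.twoStepInduction with
  | zero => exact ⟨monic_one, natDegree_one⟩
  | one =>
    rw [serrePoly, hC, ← C_mul]
    exact ⟨monic_X_sub_C _, natDegree_X_sub_C _⟩
  | more m ih ih' =>
    obtain ⟨hm, hd⟩ := ih
    obtain ⟨hm', hd'⟩ := ih'
    rw [serrePoly, hC, hC, ← C_mul]
    set P := serrePoly N (X : F[X][X]) (C X) (m + 1)
    set P' := serrePoly N (X : F[X][X]) (C X) m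
    set u : F[X] := C (qz (N - 2 * (m + 1))) * X
    set t : F[X] := C (qint (m + 1) * qint (m - N) * qz (N - 2 * (m + 1)))
    have h1 : ((X - C u) * P).Monic := (monic_X_sub_C u).mul hm'
    have h2 : ((X - C u) * P).natDegree = m + 2 := by
      rw [(monic_X_sub_C u).natDegree_mul hm', natDegree_X_sub_C, hd']
      ring
    have h3 : (C t * P').natDegree < ((X - C u) * P).natDegree := by
      refine (natDegree_C_mul_le t P').trans_lt ?_
      rw [hd, h2]
      lia
    exact ⟨h1.sub_of_left (degree_lt_degree h3),
      by rw [natDegree_sub_eq_left_of_natDegree_lt h3, h2]⟩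

/-- A polynomial in two variables vanishing at the common zeros of `f` (in the inner variable) and
of the monic polynomial `S` lies in the ideal they generate, when these zeros are distinct. -/
lemma dvd_coeff_modByMonic {k K : Type*} [Field k] [Field K] [Algebra k K] {W S : k[X][X]}
    (hS : S.Monic) {f : k[X]} {n : ℕ} {ρ : ℕ → K} (hρ : Function.Injective ρ)
    (hf : f.map (algebraMap k K) = ∏ i ∈ Finset.range n, (X - C (ρ i)))
    {τ : ℕ → ℕ → K} (hτ : ∀ i, Function.Injective (τ i))
    (hSτ : ∀ i < n, ∀ j < S.natDegree, aevalTower (aeval (ρ i)) (τ i j) S = 0)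
    (hWτ : ∀ i < n, ∀ j < S.natDegree, aevalTower (aeval (ρ i)) (τ i j) W = 0) (d : ℕ) :
    f ∣ (W %ₘ S).coeff d := by
  rw [← map_dvd_map' (algebraMap k K), hf]
  refine Finset.prod_dvd_of_coprime ((pairwise_coprime_X_sub_C hρ).set_pairwise _) fun i hi => ?_
  rw [Finset.mem_range] at hi
  have hev : ∀ P : k[X][X], ∀ j, aevalTower (aeval (ρ i)) (τ i j) P
      = (P.map (aeval (ρ i) : k[X] →ₐ[k] K).toRingHom).eval (τ i j) := by
    intro P j
    rw [eval_map]
    rfl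
  have h0 : (W %ₘ S).map (aeval (ρ i) : k[X] →ₐ[k] K).toRingHom = 0 := by
    refine eq_zero_of_degree_lt_of_eval_index_eq_zero (Finset.range S.natDegree)
      (hτ i).injOn ?_ fun j hj => ?_
    · rw [Finset.card_range, ← degree_eq_natDegree hS.ne_zero]
      exact degree_map_le.trans_lt (degree_modByMonic_lt _ hS)
    · rw [Finset.mem_range] at hj
      have h := congrArg (aevalTower (aeval (ρ i)) (τ i j)) (modByMonic_add_div W S)
      rw [map_add, map_mul, hSτ i hi j hj, hWτ i hi j hj, zero_mul, add_zero] at h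
      rw [← hev, h]
  have h1 := congrArg (fun P => coeff P d) h0
  simp only [coeff_map, coeff_zero] at h1
  rw [dvd_iff_isRoot, IsRoot, eval_map_algebraMap]
  exact h1

end Ideal

lemma eigval_injective {K : Type*} [Field K] [Algebra F K] {c : K} (hc : c ≠ 0) :
    Function.Injective (eigval c) := fun _ _ h =>
  qint_injective ((algebraMap F K).injective (mul_left_cancel₀ hc h))

open Polynomial in
/-- In `F[R][L]`, the relation `serrePoly = 0` of degree `N + 1` together with
`rootPoly R (k + 1) = 0` implies `serrePoly N L R N * idpSum R k = [N]! * idpSum L (k + N)`. -/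
theorem rootPoly_dvd_coeff_modByMonic (N k d : ℕ) :
    rootPoly (X : F[X]) (k + 1) ∣
      ((serrePoly N (X : F[X][X]) (C X) N * C (idpSum (X : F[X]) k)
        - algebraMap F F[X][X] (qfact N) * idpSum (X : F[X][X]) (k + N))
          %ₘ serrePoly N (X : F[X][X]) (C X) (N + 1)).coeff d := by
  obtain ⟨c, hc⟩ := IsAlgClosed.exists_pow_nat_eq
    (-algebraMap F (AlgebraicClosure F) (qz (-1))) two_pos
  have hc0 : c ≠ 0 := by
    rintro rfl
    simp [qz_ne_zero] at hc
  have hev : ∀ ρ τ : AlgebraicClosure F, ∀ m,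
      aevalTower (aeval ρ) τ (serrePoly N (X : F[X][X]) (C X) m) = serrePoly N τ ρ m := by
    intro ρ τ m
    rw [map_serrePoly, aevalTower_X, aevalTower_C, aeval_X]
  refine dvd_coeff_modByMonic (K := AlgebraicClosure F) (n := k + 1)
    (ρ := fun i => eigval c ((k : ℤ) - 2 * i))
    (τ := fun i j => eigval c (((k + N : ℕ) : ℤ) - 2 * ((i + j : ℕ) : ℤ)))
    (monic_serrePoly N (N + 1)).1 ?_ ?_ ?_ ?_ ?_ d
  · intro i j h
    have := eigval_injective hc0 h
    lia
  · have h1 : (rootPoly (X : F[X]) (k + 1)).map (algebraMap F (AlgebraicClosure F))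
        = rootPoly (X : (AlgebraicClosure F)[X]) (k + 1) := by
      have := map_rootPoly (mapAlgHom (Algebra.ofId F (AlgebraicClosure F))) (X : F[X]) (k + 1)
      rw [coe_mapAlgHom, map_X] at this
      exact this
    have h2 : (C c : (AlgebraicClosure F)[X]) ^ 2
        = -algebraMap F (AlgebraicClosure F)[X] (qz (-1)) := by
      rw [← C_pow, hc, C_neg]; rfl
    rw [h1, rootPoly_eq_prod h2]
    refine Finset.prod_congr rfl fun i _ => ?_
    rw [eigval, eigval, C_mul]
    push_cast
    rw [add_sub_cancel_right]
    rfl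
  · intro i a b h
    have := eigval_injective hc0 h
    lia
  · intro i hi j hj
    rw [(monic_serrePoly N (N + 1)).2] at hj
    rw [hev]
    exact (serrePoly_eigval hc (by lia) (by lia)).1
  · intro i hi j hj
    rw [(monic_serrePoly N (N + 1)).2] at hj
    rw [map_sub, map_mul, map_mul, hev, AlgHom.commutes, aevalTower_C, map_idpSum, map_idpSum,
      aevalTower_X, aeval_X, (serrePoly_eigval hc (by lia) (by lia)).2, sub_self]

section Action

open Polynomial

variable {A : Type*} [Ring A] [Algebra F A]

/-- The action of `F[R][L]` on `A`, with `L` and `R` acting by left and right multiplication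
by `B`. -/
def twoSidedAction (B : A) : F[X][X] →ₐ[F] Module.End F A :=
  eval₂AlgHom (aeval (LinearMap.mulRight F B)) (LinearMap.mulLeft F B) fun f => by
    refine Polynomial.induction_on' (motive := fun f => Commute (aeval _ f) _) f ?_ ?_
    · intro f g hf hg
      rw [map_add]
      exact hf.add_left hg
    · intro n a
      rw [aeval_monomial]
      exact (Algebra.commute_algebraMap_left a _).mul_left
        ((LinearMap.commute_mulLeft_right B B).symm.pow_left n)

lemma twoSidedAction_X (B a : A) : twoSidedAction B X a = B * a := by
  have : twoSidedAction B X = LinearMap.mulLeft F B := eval₂_X _ _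
  rw [this, LinearMap.mulLeft_apply]

lemma twoSidedAction_C (B a : A) (f : F[X]) : twoSidedAction B (C f) a = a * aeval B f := by
  have : twoSidedAction B (C f) = aeval (LinearMap.mulRight F B) f := eval₂_C _ _
  rw [this]
  induction f using Polynomial.induction_on' with
  | add f g hf hg =>
    rw [map_add, LinearMap.add_apply, hf (eval₂_C _ _), hg (eval₂_C _ _), map_add, mul_add]
  | monomial n t =>
    rw [aeval_monomial, aeval_monomial, LinearMap.pow_mulRight, ← Algebra.smul_def,
      ← Algebra.smul_def, LinearMap.smul_apply, LinearMap.mulRight_apply, mul_smul_comm]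

lemma twoSidedAction_aeval_X (B a : A) (f : F[X]) :
    twoSidedAction B (aeval (X : F[X][X]) f) a = aeval B f * a := by
  have h : twoSidedAction B X = Algebra.lmul F A B := LinearMap.ext fun a => twoSidedAction_X B a
  rw [← aeval_algHom_apply, h, aeval_algHom_apply]
  rfl

lemma twoSidedAction_serrePoly {B : A} {N : ℕ} {b : ℤ → A} (hneg : ∀ m : ℤ, m < 0 → b m = 0)
    (hrec : ∀ m : ℤ, 0 ≤ m →
      B * b m - qz ((N : ℤ) - 2 * m) • (b m * B)
        = qint (m + 1) • b (m + 1)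
          + (qint (m - 1 - (N : ℤ)) * qz ((N : ℤ) - 2 * m)) • b (m - 1)) (m : ℕ) :
    twoSidedAction B (serrePoly N X (C X) m) (b 0) = qfact m • b m := by
  have hstep : ∀ (t : F) (P : F[X][X]) (a : A),
      twoSidedAction B ((X - algebraMap F F[X][X] t * C X) * P) a
        = B * twoSidedAction B P a - t • (twoSidedAction B P a * B) := by
    intro t P a
    rw [map_mul, Module.End.mul_apply, map_sub, LinearMap.sub_apply, twoSidedAction_X,
      ← Algebra.smul_def, map_smul, LinearMap.smul_apply, twoSidedAction_C, aeval_X]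
  induction m using Nat.twoStepInduction with
  | zero => simp [serrePoly, qfact_zero]
  | one =>
    have h := hrec 0 le_rfl
    rw [hneg (0 - 1) (by lia)] at h
    have h' := hstep (qz N) 1 (b 0)
    rw [mul_one, map_one, Module.End.one_apply] at h'
    rw [serrePoly, h']
    simpa [qfact_succ, qfact_zero] using h
  | more m ih ih' =>
    have h := congrArg (qfact (m + 1) • ·) (hrec (m + 1) (by lia))
    rw [serrePoly, map_sub, LinearMap.sub_apply, hstep, ih', ← Algebra.smul_def, map_smul,
      LinearMap.smul_apply, ih, qfact_succ (m + 1), sub_eq_iff_eq_add]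
    simp only [smul_sub, smul_add, Nat.cast_add, Nat.cast_one, Nat.cast_ofNat,
      add_sub_cancel_right, smul_smul, smul_mul_assoc, mul_smul_comm, add_assoc,
      one_add_one_eq_two] at h ⊢
    rw [mul_comm (qz _), h, qfact_succ]
    congr 2
    ring

lemma aeval_idpSum_smul {B : A} {M : Type*} [AddCommGroup M] [Module A M] {p : ZMod 2} {v : M}
    {k : ℕ} (hk : (k : ZMod 2) = p) (h : ∀ j : ℕ, k < j → idp B p (j : ℤ) • v = 0) :
    aeval B (idpSum (X : F[X]) k) • v
      = ∑ᶠ j : ℕ, if ((j : ZMod 2) = p) then idp B p (j : ℤ) • v else 0 := by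
  rw [← sum_idp_eq_idpSum X hk, map_sum, Finset.sum_smul,
    finsum_eq_sum_of_support_subset (s := Finset.range (k + 1))]
  · refine Finset.sum_congr rfl fun j _ => ?_
    split_ifs
    · rw [map_idp, aeval_X]
    · simp
  · intro j hj
    by_contra hj'
    rw [Finset.mem_coe, Finset.mem_range, not_lt] at hj'
    simp [h j hj'] at hj

lemma twoSidedAction_smul_eq_zero {B a : A} {M : Type*} [AddCommGroup M] [Module A M] {v : M}
    {f : F[X]} (hf : aeval B f • v = 0) {P : F[X][X]} (hP : ∀ d, f ∣ P.coeff d) :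
    twoSidedAction B P a • v = 0 := by
  rw [P.as_sum_range_C_mul_X_pow, map_sum, LinearMap.sum_apply, Finset.sum_smul]
  refine Finset.sum_eq_zero fun d _ => ?_
  obtain ⟨g, hg⟩ := hP d
  have hX : (X : F[X][X]) ^ d = aeval (X : F[X][X]) (X ^ d : F[X]) := by simp
  rw [mul_comm, hX, map_mul, Module.End.mul_apply, twoSidedAction_C, hg, mul_comm f g,
    twoSidedAction_aeval_X, map_mul, ← mul_assoc, ← mul_assoc, mul_smul, hf, smul_zero]

lemma aeval_rootPoly_smul_eq_zero {B : A} {M : Type*} [AddCommGroup M] [Module A M] {p : ZMod 2}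
    {v : M} {k : ℕ} (hk : (k : ZMod 2) = p) (h : idp B p ((k + 1 : ℕ) : ℤ) • v = 0) :
    aeval B (rootPoly (X : F[X]) (k + 1)) • v = 0 := by
  have h1 := congrArg (qfact (k + 1) • aeval B ·) (idp_succ_of_eq (X : F[X]) hk)
  simp only [map_smul, smul_inv_smul₀ (qfact_ne_zero _), map_idp, aeval_X] at h1
  rw [← h1, ← mul_one (idp B p _), ← mul_smul_comm, Algebra.smul_def, mul_one,
    ← Algebra.commutes, mul_smul, h, smul_zero]

theorem smul_aeval_idpSum_smul {B : A} {N : ℕ} {b : ℤ → A} (hneg : ∀ m : ℤ, m < 0 → b m = 0)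
    (htop : b (N + 1) = 0)
    (hrec : ∀ m : ℤ, 0 ≤ m →
      B * b m - qz ((N : ℤ) - 2 * m) • (b m * B)
        = qint (m + 1) • b (m + 1)
          + (qint (m - 1 - (N : ℤ)) * qz ((N : ℤ) - 2 * m)) • b (m - 1))
    {M : Type*} [AddCommGroup M] [Module A M] {v : M} {k : ℕ}
    (hv : aeval B (rootPoly (X : F[X]) (k + 1)) • v = 0) :
    b N • aeval B (idpSum (X : F[X]) k) • v
      = aeval B (idpSum (X : F[X]) (k + N)) • b 0 • v := by
  have hS : twoSidedAction B (serrePoly N X (C X) (N + 1)) (b 0) = 0 := by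
    rw [twoSidedAction_serrePoly hneg hrec, Nat.cast_add, Nat.cast_one, htop, smul_zero]
  have hX : idpSum (X : F[X][X]) (k + N) = aeval (X : F[X][X]) (idpSum (X : F[X]) (k + N)) := by
    rw [map_idpSum, aeval_X]
  set W := serrePoly N (X : F[X][X]) (C X) N * C (idpSum (X : F[X]) k)
    - algebraMap F F[X][X] (qfact N) * idpSum (X : F[X][X]) (k + N) with hW
  have h0 := twoSidedAction_smul_eq_zero (a := b 0) hv (rootPoly_dvd_coeff_modByMonic N k)
  have h1 : twoSidedAction B (W %ₘ serrePoly N X (C X) (N + 1)) (b 0)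
      = qfact N • (b N * aeval B (idpSum (X : F[X]) k)
        - aeval B (idpSum (X : F[X]) (k + N)) * b 0) := by
    have h2 := congrArg (twoSidedAction B · (b 0))
      (modByMonic_add_div W (serrePoly N X (C X) (N + 1)))
    rw [map_add, LinearMap.add_apply, mul_comm (serrePoly N (X : F[X][X]) (C X) (N + 1)), map_mul,
      Module.End.mul_apply, hS, map_zero, add_zero] at h2
    rw [h2, hW, map_sub, LinearMap.sub_apply, mul_comm (serrePoly N (X : F[X][X]) (C X) N), map_mul,
      Module.End.mul_apply, twoSidedAction_serrePoly hneg hrec, twoSidedAction_C,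
      ← Algebra.smul_def, map_smul, LinearMap.smul_apply, hX, twoSidedAction_aeval_X,
      smul_mul_assoc, smul_sub]
  rw [h1] at h0
  have h3 := congrArg (algebraMap F A (qfact N)⁻¹ • ·) h0
  simp only [smul_zero] at h3
  rw [← mul_smul, ← Algebra.smul_def, inv_smul_smul₀ (qfact_ne_zero N), sub_smul, mul_smul,
    mul_smul, sub_eq_zero] at h3
  exact h3

end Action

end SplitIdp

/-- Proposition B (split rank-two identity on modules, Proposition `prop:BBij0` of the paper):
given a family `(b_m)` vanishing for `m < 0` and `m > N` and satisfying the recursion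
`B·b_m − q^{N−2m}·b_m·B = [m+1]·b_{m+1} + [m−1−N]·q^{N−2m}·b_{m−1}`, a left `A`-module `M`,
a parity `p`, and `v ∈ M` with `B^{(k)}_{p̄}v = 0` and `B^{(k)}_{(p+N) mod 2}(b₀v) = 0` for
all `k > K₀`, one has
`b_N·(Σ_{k≥0, k≡p} B^{(k)}_{p̄} v) = Σ_{k≥0, k≡p+N} B^{(k)}_{(p+N) mod 2} (b₀ v)`. -/
theorem statement9 (A : Type*) [Ring A] [Algebra F A] (B : A)
    (N : ℕ) (b : ℤ → A)
    (hneg : ∀ m : ℤ, m < 0 → b m = 0)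
    (hbig : ∀ m : ℤ, (N : ℤ) < m → b m = 0)
    (hrec : ∀ m : ℤ, 0 ≤ m →
      B * b m - qz ((N : ℤ) - 2 * m) • (b m * B)
        = qint (m + 1) • b (m + 1)
          + (qint (m - 1 - (N : ℤ)) * qz ((N : ℤ) - 2 * m)) • b (m - 1))
    (M : Type*) [AddCommGroup M] [Module A M]
    (p : ZMod 2) (v : M) (K0 : ℕ)
    (h1 : ∀ k : ℕ, K0 < k → idp B p (k : ℤ) • v = 0)
    (h2 : ∀ k : ℕ, K0 < k → idp B (p + (N : ZMod 2)) (k : ℤ) • (b 0 • v) = 0) :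
    b (N : ℤ) • (∑ᶠ k : ℕ, if ((k : ZMod 2) = p) then idp B p (k : ℤ) • v else 0)
      = ∑ᶠ k : ℕ,
          if ((k : ZMod 2) = p + (N : ZMod 2)) then
            idp B (p + (N : ZMod 2)) (k : ℤ) • (b 0 • v)
          else 0 := by
  set k : ℕ := 2 * K0 + p.val
  have hk : (k : ZMod 2) = p := by
    have h : ((2 : ℕ) : ZMod 2) = 0 := ZMod.natCast_self 2
    rw [Nat.cast_add, Nat.cast_mul, h, zero_mul, zero_add, ZMod.natCast_zmod_val]
  have hkN : ((k + N : ℕ) : ZMod 2) = p + (N : ZMod 2) := by rw [Nat.cast_add, hk]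
  rw [← aeval_idpSum_smul hk fun j hj => h1 j (by lia),
    ← aeval_idpSum_smul hkN fun j hj => h2 j (by lia)]
  exact smul_aeval_idpSum_smul hneg (hbig _ (by lia)) hrec
    (aeval_rootPoly_smul_eq_zero hk (h1 (k + 1) (by lia)))
end
end

section
/- On the module L(n) of the context with n ≥ 1, set p := n mod 2. For every integer ℓ with 0 ≤ 2ℓ ≤ n−1, the following identity holds: v_{n−1−2ℓ} = Σ_{c=0}^{⌊(n−1)/2⌋−ℓ} (−1)^c q^{−(2ℓ+3)c} ⌊ℓ+c ¦ c⌋_{q²} · B^{(n−1−2ℓ−2c)}_{p̄}(v₀). (This inverts the expansion of the icanonical basis in the canonical basis of L(n), odd-indexed case.) -/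
set_option synthInstance.maxHeartbeats 1000000
set_option maxHeartbeats 2000000

noncomputable section

namespace Lnmod

/-- The base field `F = ℚ(q)`. -/
abbrev F : Type := RatFunc ℚ

/-- `q^e` for `e : ℤ`. -/
def qz (e : ℤ) : F := (RatFunc.X : F) ^ e

/-- The quantum integer `[n]`. -/
def qint (n : ℤ) : F := (qz n - qz (-n)) / (qz 1 - qz (-1))

/-- The quantum factorial `[n]!`. -/
def qfact (n : ℕ) : F := ∏ i ∈ Finset.range n, qint ((i : ℤ) + 1)

/-- The balanced Gaussian binomial coefficient in the variable `q²`. -/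
def qbinom2 (a : ℤ) (k : ℕ) : F :=
  ∏ s ∈ Finset.range k,
    (qz (2 * (a - s)) - qz (-(2 * (a - s)))) /
      (qz (2 * ((s : ℤ) + 1)) - qz (-(2 * ((s : ℤ) + 1))))

/-- The underlying space of the simple `U_q(sl₂)`-module `L(n)`, with basis `v₀, …, v_n`. -/
abbrev V (n : ℕ) : Type := Fin (n + 1) → F

/-- The basis vector `v_k` of `L(n)`. -/
def vb (n : ℕ) (k : Fin (n + 1)) : V n := Pi.single k 1

/-- The operator `F` on `L(n)`: `F(v_k) = [k+1]·v_{k+1}` (and `v_{n+1} = 0`). -/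
def Fop (n : ℕ) : Module.End F (V n) :=
  Matrix.toLin'
    (Matrix.of fun i j : Fin (n + 1) =>
      if (i : ℕ) = (j : ℕ) + 1 then qint ((j : ℕ) + 1) else 0)

/-- The operator `E` on `L(n)`: `E(v_k) = [n+1−k]·v_{k−1}` (and `v_{−1} = 0`). -/
def Eop (n : ℕ) : Module.End F (V n) :=
  Matrix.toLin'
    (Matrix.of fun i j : Fin (n + 1) =>
      if (i : ℕ) + 1 = (j : ℕ) then qint ((n : ℤ) + 1 - (j : ℕ)) else 0)

/-- The operator `K⁻¹` on `L(n)`: `K⁻¹(v_k) = q^{−(n−2k)}·v_k`. -/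
def Kinvop (n : ℕ) : Module.End F (V n) :=
  Matrix.toLin'
    (Matrix.of fun i j : Fin (n + 1) =>
      if i = j then qz (-((n : ℤ) - 2 * (i : ℕ))) else 0)

/-- `B := F + q^{−1}·E·K^{−1}`. -/
def Bop (n : ℕ) : Module.End F (V n) := Fop n + qz (-1) • (Eop n * Kinvop n)

/-- The idivided powers `B^{(m)}_{p̄}` of an element `B`, with parameter `ς = q^{−1}`:
`B^{(0)}_{p̄} = 1`; for `m ≥ 1`,
`B^{(m)}_{0̄} = (1/[m]!)·B^{1+δ}·∏_{r=1}^{⌈m/2⌉−1}(B² − [2r]²·1)` (δ = 1 iff m even), and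
`B^{(m)}_{1̄} = (1/[m]!)·B^{ε}·∏_{r=1}^{⌊m/2⌋}(B² − [2r−1]²·1)` (ε = 1 iff m odd);
`B^{(m)}_{p̄} = 0` for `m < 0`. -/
def idp {A : Type*} [Ring A] [Algebra F A] (B : A) (p : ZMod 2) (m : ℤ) : A :=
  if m < 0 then 0
  else if m = 0 then 1
  else if p = 0 then
    (qfact m.toNat)⁻¹ •
      (B ^ (if m % 2 = 0 then 2 else 1) *
        ((List.range ((m.toNat + 1) / 2 - 1)).map
            (fun r => B ^ 2 - (qint (2 * ((r : ℤ) + 1)) ^ 2) • (1 : A))).prod)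
  else
    (qfact m.toNat)⁻¹ •
      (B ^ (if m % 2 = 0 then 0 else 1) *
        ((List.range (m.toNat / 2)).map
            (fun r => B ^ 2 - (qint (2 * ((r : ℤ) + 1) - 1) ^ 2) • (1 : A))).prod)

end Lnmod

open Lnmod

namespace Lnmod

lemma qz_add (a b : ℤ) : qz (a + b) = qz a * qz b :=
  zpow_add₀ RatFunc.X_ne_zero a b

lemma qz_neg (a : ℤ) : qz (-a) = (qz a)⁻¹ := zpow_neg _ _

lemma qz_sub (a b : ℤ) : qz (a - b) = qz a * (qz b)⁻¹ := by
  rw [sub_eq_add_neg, qz_add, qz_neg]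

lemma qz_ofNat_mul (k : ℕ) [k.AtLeastTwo] (a : ℤ) :
    qz ((ofNat(k) : ℤ) * a) = qz a ^ (ofNat(k) : ℕ) := by
  rw [qz, mul_comm, zpow_mul]
  exact zpow_natCast _ _

lemma qz_ofNat (k : ℕ) [k.AtLeastTwo] :
    qz (ofNat(k) : ℤ) = RatFunc.X ^ (ofNat(k) : ℕ) :=
  zpow_natCast _ _

lemma qz_zero : qz 0 = 1 := zpow_zero _

lemma qz_one : qz 1 = RatFunc.X := zpow_one _

lemma qz_natCast (k : ℕ) : qz k = RatFunc.X ^ k := zpow_natCast _ _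

lemma qz_ne_zero (a : ℤ) : qz a ≠ 0 := zpow_ne_zero _ RatFunc.X_ne_zero

lemma X_pow_ne_one {k : ℕ} (hk : k ≠ 0) : (RatFunc.X : F) ^ k ≠ 1 := by
  intro h
  have h' : algebraMap (Polynomial ℚ) F (Polynomial.X ^ k) = algebraMap (Polynomial ℚ) F 1 := by
    simpa using h
  have := congrArg Polynomial.natDegree (RatFunc.algebraMap_injective ℚ h')
  simp at this
  exact hk this

lemma qz_sub_qz_neg_ne_zero {k : ℕ} (hk : k ≠ 0) : qz k - qz (-k) ≠ 0 := by
  intro h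
  rw [sub_eq_zero, qz_neg, ← mul_eq_one_iff_eq_inv₀ (qz_ne_zero _), qz_natCast, ← pow_add] at h
  exact X_pow_ne_one (by omega) h

lemma qint_zero : qint 0 = 0 := by simp [qint]

lemma qint_one : qint 1 = 1 := by
  have h : qz 1 - qz (-1) ≠ 0 := by exact_mod_cast qz_sub_qz_neg_ne_zero one_ne_zero
  exact div_self h

lemma qint_natCast_ne_zero {k : ℕ} (hk : k ≠ 0) : qint k ≠ 0 :=
  div_ne_zero (qz_sub_qz_neg_ne_zero hk)
    (by exact_mod_cast qz_sub_qz_neg_ne_zero one_ne_zero)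

/-- The vector `v_k` of `L(n)` for an integer index, zero when `k` is out of range. -/
def vz (n : ℕ) (k : ℤ) : V n := fun i => if (i : ℤ) = k then 1 else 0

lemma vz_eq_vb (n : ℕ) (k : Fin (n + 1)) : vz n (k : ℕ) = vb n k := by
  ext i
  simp [vz, vb, Pi.single_apply, Fin.ext_iff]

lemma vz_eq_zero {n : ℕ} {k : ℤ} (h : k < 0 ∨ (n : ℤ) < k) : vz n k = 0 := by
  ext i
  have := i.isLt
  simp only [vz, Pi.zero_apply, ite_eq_right_iff, one_ne_zero, imp_false]
  omega

lemma exists_fin_of_mem {n : ℕ} {k : ℤ} (h : ¬(k < 0 ∨ (n : ℤ) < k)) :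
    ∃ j : Fin (n + 1), k = (j : ℕ) :=
  ⟨⟨k.toNat, by omega⟩, by simp only []; omega⟩

lemma Fop_vz (n : ℕ) (k : ℤ) : Fop n (vz n k) = qint (k + 1) • vz n (k + 1) := by
  by_cases h : k < 0 ∨ (n : ℤ) < k
  · rw [vz_eq_zero h, map_zero]
    by_cases h' : k + 1 = 0
    · rw [h', qint_zero, zero_smul]
    · rw [vz_eq_zero (by omega), smul_zero]
  · obtain ⟨j, rfl⟩ := exists_fin_of_mem h
    rw [vz_eq_vb, vb, Fop, Matrix.toLin'_apply, Matrix.mulVec_single_one]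
    ext i
    simp only [Matrix.col_apply, Matrix.of_apply, vz, Pi.smul_apply, smul_eq_mul, mul_ite, mul_one,
      mul_zero]
    norm_cast

lemma Eop_vz (n : ℕ) (k : ℤ) : Eop n (vz n k) = qint (n + 1 - k) • vz n (k - 1) := by
  by_cases h : k < 0 ∨ (n : ℤ) < k
  · rw [vz_eq_zero h, map_zero]
    by_cases h' : n + 1 - k = 0
    · rw [h', qint_zero, zero_smul]
    · rw [vz_eq_zero (by omega), smul_zero]
  · obtain ⟨j, rfl⟩ := exists_fin_of_mem h
    rw [vz_eq_vb, vb, Eop, Matrix.toLin'_apply, Matrix.mulVec_single_one]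
    ext i
    simp only [Matrix.col_apply, Matrix.of_apply, vz, Pi.smul_apply, smul_eq_mul, mul_ite, mul_one,
      mul_zero]
    congr 1
    simp only [eq_iff_iff]
    omega

lemma Kinvop_vz (n : ℕ) (k : ℤ) : Kinvop n (vz n k) = qz (-(n - 2 * k)) • vz n k := by
  by_cases h : k < 0 ∨ (n : ℤ) < k
  · rw [vz_eq_zero h, map_zero, smul_zero]
  · obtain ⟨j, rfl⟩ := exists_fin_of_mem h
    rw [vz_eq_vb, vb, Kinvop, Matrix.toLin'_apply, Matrix.mulVec_single_one]
    ext i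
    by_cases hij : i = j <;> simp [hij]

lemma Bop_vz (n : ℕ) (k : ℤ) :
    Bop n (vz n k) = qint (k + 1) • vz n (k + 1)
      + (qz (-1 - n + 2 * k) * qint (n + 1 - k)) • vz n (k - 1) := by
  simp only [Bop, LinearMap.add_apply, LinearMap.smul_apply, Module.End.mul_apply, Fop_vz,
    Kinvop_vz, map_smul, Eop_vz, smul_smul]
  rw [← mul_assoc, ← qz_add]
  ring_nf

lemma Bop_sq_vz (n : ℕ) (k : ℤ) :
    Bop n (Bop n (vz n k)) = (qint (k + 1) * qint (k + 2)) • vz n (k + 2)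
      + (qint (k + 1) * (qz (1 - n + 2 * k) * qint (n - k))
          + qint k * (qz (-1 - n + 2 * k) * qint (n + 1 - k))) • vz n k
      + ((qz (-1 - n + 2 * k) * qint (n + 1 - k))
          * (qz (-3 - n + 2 * k) * qint (n + 2 - k))) • vz n (k - 2) := by
  rw [Bop_vz n k, map_add, map_smul, map_smul, Bop_vz, Bop_vz]
  have h1 : k + 1 + 1 = k + 2 := by ring
  have h2 : k + 1 - 1 = k := by ring
  have h3 : k - 1 + 1 = k := by ring
  have h4 : k - 1 - 1 = k - 2 := by ring
  have h5 : -1 - (n : ℤ) + 2 * (k + 1) = 1 - n + 2 * k := by ring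
  have h6 : (n : ℤ) + 1 - (k + 1) = n - k := by ring
  have h7 : -1 - (n : ℤ) + 2 * (k - 1) = -3 - n + 2 * k := by ring
  have h8 : (n : ℤ) + 1 - (k - 1) = n + 2 - k := by ring
  rw [h1, h2, h3, h4, h5, h6, h7, h8]
  simp only [smul_add, smul_smul, add_smul, mul_comm _ (qint k)]
  abel

lemma qfact_succ (k : ℕ) : qfact (k + 1) = qfact k * qint (k + 1) :=
  Finset.prod_range_succ _ _

lemma qint_natCast_add_one_ne_zero (k : ℕ) : qint ((k : ℤ) + 1) ≠ 0 := by
  exact_mod_cast qint_natCast_ne_zero k.succ_ne_zero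

lemma qfact_ne_zero (k : ℕ) : qfact k ≠ 0 :=
  Finset.prod_ne_zero_iff.2 fun i _ => qint_natCast_add_one_ne_zero i

lemma list_bind_pure_cast (L : List ℕ) :
    (do let a ← L; pure (a : ℤ)) = L.map fun a : ℕ => (a : ℤ) :=
  bind_pure_comp _ _

section idp

variable {A : Type*} [Ring A] [Algebra F A]

lemma idp_of_neg (B : A) (p : ZMod 2) {m : ℤ} (hm : m < 0) : idp B p m = 0 := if_pos hm

lemma idp_one_even (B : A) (j : ℕ) : idp B 1 (2 * j) = (qfact (2 * j))⁻¹ •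
    ((List.range j).map fun r : ℕ => B ^ 2 - (qint (2 * (r + 1) - 1) ^ 2) • (1 : A)).prod := by
  have h : (2 * (j : ℤ)).toNat = 2 * j := by omega
  rcases Nat.eq_zero_or_pos j with rfl | hj
  · simp [idp, qfact]
  · rw [idp, if_neg (by omega), if_neg (by omega), if_neg one_ne_zero, if_pos (by omega), h,
      pow_zero, one_mul, Nat.mul_div_cancel_left _ two_pos, list_bind_pure_cast, List.map_map]
    rfl

lemma idp_zero_odd (B : A) (j : ℕ) : idp B 0 (2 * j + 1) = (qfact (2 * j + 1))⁻¹ •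
    (B * ((List.range j).map fun r : ℕ => B ^ 2 - (qint (2 * (r + 1)) ^ 2) • (1 : A)).prod) := by
  have h : (2 * (j : ℤ) + 1).toNat = 2 * j + 1 := by omega
  have h' : (2 * j + 1 + 1) / 2 - 1 = j := by omega
  rw [idp, if_neg (by omega), if_neg (by omega), if_pos rfl, if_neg (by omega), h, h', pow_one,
    list_bind_pure_cast, List.map_map]
  rfl

lemma smul_mul_sub_smul_one {a b c d : F} (ha : a ≠ 0) (hb : b ≠ 0) (hc : c ≠ 0)
    (x B : A) (hx : B ^ 2 * x = x * B ^ 2) :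
    B ^ 2 * (a⁻¹ • x)
      = (b * c) • ((a * b * c)⁻¹ • (x * (B ^ 2 - d • (1 : A)))) + d • (a⁻¹ • x) := by
  have : b * c * (a * b * c)⁻¹ = a⁻¹ := by field_simp
  rw [mul_smul_comm, hx, mul_sub, mul_smul_comm, mul_one]
  simp only [smul_sub, smul_smul]
  rw [← mul_assoc, this, mul_comm d, sub_add_cancel]

lemma commute_prod_sq_sub (B : A) (f : ℕ → F) (j : ℕ) :
    Commute B ((List.range j).map fun r : ℕ => B ^ 2 - (f r) • (1 : A)).prod := by
  apply Commute.list_prod_right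
  intro y hy
  obtain ⟨r, -, rfl⟩ := List.mem_map.1 hy
  exact ((Commute.refl B).pow_right 2).sub_right ((Commute.one_right B).smul_right _)

lemma sq_mul_idp_one_even (B : A) (i : ℤ) :
    B ^ 2 * idp B 1 (2 * i) = (qint (2 * i + 1) * qint (2 * i + 2)) • idp B 1 (2 * (i + 1))
      + qint (2 * i + 1) ^ 2 • idp B 1 (2 * i) := by
  rcases lt_or_ge i 0 with hi | hi
  · rw [idp_of_neg B 1 (by omega), mul_zero, smul_zero, add_zero]
    by_cases h : 2 * i + 2 = 0
    · rw [h, qint_zero, mul_zero, zero_smul]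
    · rw [idp_of_neg B 1 (by omega), smul_zero]
  · lift i to ℕ using hi
    have e : ((i : ℤ) + 1) = ((i + 1 : ℕ) : ℤ) := by push_cast; rfl
    have e1 : 2 * (i : ℤ) + 1 = ((2 * i : ℕ) : ℤ) + 1 := by push_cast; rfl
    have e2 : 2 * (i : ℤ) + 2 = ((2 * i + 1 : ℕ) : ℤ) + 1 := by push_cast; ring
    rw [e, idp_one_even, idp_one_even, List.range_succ, List.map_append, List.prod_append,
      show 2 * (i + 1) = 2 * i + 1 + 1 from rfl, qfact_succ, qfact_succ, e1, e2]
    have e3 : 2 * ((i : ℤ) + 1) - 1 = ((2 * i : ℕ) : ℤ) + 1 := by push_cast; ring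
    simp only [List.map_cons, List.map_nil, List.prod_cons, List.prod_nil, mul_one, e3]
    exact smul_mul_sub_smul_one (qfact_ne_zero _) (qint_natCast_add_one_ne_zero _)
      (qint_natCast_add_one_ne_zero _) _ B ((commute_prod_sq_sub B _ _).pow_left 2)

lemma sq_mul_idp_zero_odd (B : A) (i : ℤ) :
    B ^ 2 * idp B 0 (2 * i + 1) = (qint (2 * i + 2) * qint (2 * i + 3)) • idp B 0 (2 * (i + 1) + 1)
      + qint (2 * i + 2) ^ 2 • idp B 0 (2 * i + 1) := by
  rcases lt_or_ge i 0 with hi | hi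
  · rw [idp_of_neg B 0 (by omega), mul_zero, smul_zero, add_zero]
    by_cases h : 2 * i + 2 = 0
    · rw [h, qint_zero, zero_mul, zero_smul]
    · rw [idp_of_neg B 0 (by omega), smul_zero]
  · lift i to ℕ using hi
    have e : ((i : ℤ) + 1) = ((i + 1 : ℕ) : ℤ) := by push_cast; rfl
    have e1 : 2 * (i : ℤ) + 2 = ((2 * i + 1 : ℕ) : ℤ) + 1 := by push_cast; ring
    have e2 : 2 * (i : ℤ) + 3 = ((2 * i + 2 : ℕ) : ℤ) + 1 := by push_cast; ring
    rw [e, idp_zero_odd, idp_zero_odd, List.range_succ, List.map_append, List.prod_append,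
      show 2 * (i + 1) + 1 = 2 * i + 2 + 1 from rfl, qfact_succ (2 * i + 2),
      show 2 * i + 2 = 2 * i + 1 + 1 from rfl, qfact_succ (2 * i + 1), e1, e2]
    have e3 : 2 * ((i : ℤ) + 1) = ((2 * i + 1 : ℕ) : ℤ) + 1 := by push_cast; ring
    simp only [List.map_cons, List.map_nil, List.prod_cons, List.prod_nil, mul_one, e3]
    rw [← mul_assoc B]
    exact smul_mul_sub_smul_one (qfact_ne_zero _) (qint_natCast_add_one_ne_zero _)
      (qint_natCast_add_one_ne_zero _) _ B
      (((Commute.refl B).mul_right (commute_prod_sq_sub B _ _)).pow_left 2)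

end idp

/-- The unnormalised quantum integer `q^{2x} - q^{-2x}` of the variable `q²`. -/
def qdiff2 (x : ℤ) : F := qz (2 * x) - qz (-(2 * x))

lemma qdiff2_zero : qdiff2 0 = 0 := by simp [qdiff2]

lemma qdiff2_natCast_add_one_ne_zero (k : ℕ) : qdiff2 ((k : ℤ) + 1) ≠ 0 := by
  have := qz_sub_qz_neg_ne_zero (k := 2 * (k + 1)) (by omega)
  exact_mod_cast this

lemma qdiff2_natCast_add_two_ne_zero (k : ℕ) : qdiff2 ((k : ℤ) + 2) ≠ 0 := by
  have := qdiff2_natCast_add_one_ne_zero (k + 1)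
  push_cast at this
  rwa [add_assoc] at this

/-- The unnormalised quantum factorial of the variable `q²`. -/
def qdiffFact2 (k : ℕ) : F := ∏ i ∈ Finset.range k, qdiff2 ((i : ℤ) + 1)

lemma qdiffFact2_succ (k : ℕ) : qdiffFact2 (k + 1) = qdiffFact2 k * qdiff2 (k + 1) :=
  Finset.prod_range_succ _ _

lemma qdiffFact2_ne_zero (k : ℕ) : qdiffFact2 k ≠ 0 :=
  Finset.prod_ne_zero_iff.2 fun i _ => qdiff2_natCast_add_one_ne_zero i

lemma qbinom2_add (l c : ℕ) :
    qbinom2 ((l : ℤ) + c) c = qdiffFact2 (l + c) / (qdiffFact2 l * qdiffFact2 c) := by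
  have h : ∏ s ∈ Finset.range c, qdiff2 ((l : ℤ) + c - s)
      = ∏ s ∈ Finset.range c, qdiff2 (((l + s : ℕ) : ℤ) + 1) := by
    rw [← Finset.prod_range_reflect]
    refine Finset.prod_congr rfl fun s hs => ?_
    rw [Finset.mem_range] at hs
    congr 1
    omega
  rw [eq_div_iff (mul_ne_zero (qdiffFact2_ne_zero _) (qdiffFact2_ne_zero _))]
  have h' : qbinom2 ((l : ℤ) + c) c
      = (∏ s ∈ Finset.range c, qdiff2 ((l : ℤ) + c - s)) / qdiffFact2 c :=
    Finset.prod_div_distrib _ _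
  rw [h', h, qdiffFact2.eq_1 (l + c), Finset.prod_range_add, ← qdiffFact2]
  field_simp [qdiffFact2_ne_zero c]

/-- The coefficient of `B^{(m - 2c)} v₀` in the expansion of `v_m`, where `m = n - 1 - 2l`. -/
def invCoeff (l c : ℕ) : F :=
  (-1 : F) ^ c * qz (-((2 * (l : ℤ) + 3) * c)) * qbinom2 ((l : ℤ) + c) c

lemma invCoeff_zero (l : ℕ) : invCoeff l 0 = 1 := by
  simp [invCoeff, qbinom2, qz_zero]

/-- The factor shared by the coefficients `invCoeff l c`, `invCoeff (l + 1) c`,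
`invCoeff (l + 1) (c - 1)` and `invCoeff (l + 2) (c - 2)`. -/
def invCoeffFactor (l c : ℕ) : F :=
  (-1 : F) ^ c * qz (-((2 * (l : ℤ) + 3) * c)) * qdiffFact2 (l + c)
    / (qdiffFact2 (l + 2) * qdiffFact2 c)

lemma invCoeff_eq (l c : ℕ) :
    invCoeff l c = invCoeffFactor l c * (qdiff2 (l + 1) * qdiff2 (l + 2)) := by
  have h2 := qdiff2_natCast_add_two_ne_zero l
  have e : (((l + 1 : ℕ) : ℤ) + 1) = (l : ℤ) + 2 := by push_cast; ring
  rw [invCoeff, invCoeffFactor, qbinom2_add, qdiffFact2_succ (l + 1), qdiffFact2_succ l, e]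
  field_simp [qdiffFact2_ne_zero, qdiff2_natCast_add_one_ne_zero]

lemma invCoeff_succ_left (l c : ℕ) :
    invCoeff (l + 1) c
      = invCoeffFactor l c * (qz (-(2 * c)) * qdiff2 (l + 2) * qdiff2 (l + c + 1)) := by
  have h2 := qdiff2_natCast_add_two_ne_zero l
  have e : (((l + 1 : ℕ) : ℤ) + 1) = (l : ℤ) + 2 := by push_cast; ring
  have e' : -((2 * ((l + 1 : ℕ) : ℤ) + 3) * c) = -((2 * (l : ℤ) + 3) * c) + -(2 * c) := by
    push_cast; ring
  rw [invCoeff, invCoeffFactor, qbinom2_add, qdiffFact2_succ (l + 1), e, e', qz_add,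
    show l + 1 + c = l + c + 1 by ring, qdiffFact2_succ (l + c)]
  push_cast
  field_simp [qdiffFact2_ne_zero]

lemma invCoeff_pred_right (l c : ℕ) :
    invCoeff (l + 1) c
      = -(invCoeffFactor l (c + 1)
          * (qz (-(2 * (c + 1)) + 2 * l + 5) * qdiff2 (l + 2) * qdiff2 (c + 1))) := by
  have h2 := qdiff2_natCast_add_two_ne_zero l
  have h1 := qdiff2_natCast_add_one_ne_zero c
  have e : (((l + 1 : ℕ) : ℤ) + 1) = (l : ℤ) + 2 := by push_cast; ring
  have e' : -((2 * ((l + 1 : ℕ) : ℤ) + 3) * c)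
      = -((2 * (l : ℤ) + 3) * (c + 1 : ℕ)) + (-(2 * (c + 1)) + 2 * l + 5) := by
    push_cast; ring
  rw [invCoeff, invCoeffFactor, qbinom2_add, qdiffFact2_succ (l + 1), e, e', qz_add,
    show l + 1 + c = l + (c + 1) by ring, qdiffFact2_succ c]
  field_simp [qdiffFact2_ne_zero]
  ring

lemma invCoeff_pred_pred_right (l c : ℕ) :
    invCoeff (l + 2) c
      = invCoeffFactor l (c + 2)
          * (qz (-(4 * (c + 2)) + 4 * l + 14) * qdiff2 (c + 2) * qdiff2 (c + 1)) := by
  have h1 := qdiff2_natCast_add_one_ne_zero c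
  have h2 := qdiff2_natCast_add_two_ne_zero c
  have e : (((c + 1 : ℕ) : ℤ) + 1) = (c : ℤ) + 2 := by push_cast; ring
  have e' : -((2 * ((l + 2 : ℕ) : ℤ) + 3) * c)
      = -((2 * (l : ℤ) + 3) * (c + 2 : ℕ)) + (-(4 * (c + 2)) + 4 * l + 14) := by
    push_cast; ring
  rw [invCoeff, invCoeffFactor, qbinom2_add, e', qz_add,
    show l + 2 + c = l + (c + 2) by ring, qdiffFact2_succ (c + 1), qdiffFact2_succ c, e]
  field_simp [qdiffFact2_ne_zero]
  ring

/-- The three-term recurrence between the inversion coefficients, with the common factor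
`invCoeffFactor` removed. -/
lemma qdiff2_three_term (m l c n : ℤ) (hn : n = m + 3 + 2 * l) :
    qint (m + 1) * qint (m + 2) * (qdiff2 (l + 1) * qdiff2 (l + 2))
      = qint (m - 2 * c + 1) * qint (m - 2 * c + 2)
          * (qz (-(2 * c)) * qdiff2 (l + 2) * qdiff2 (l + c + 1))
        - (qint (m - 2 * c + 3) ^ 2
            - (qint (m + 1) * (qz (1 - n + 2 * m) * qint (n - m))
              + qint m * (qz (-1 - n + 2 * m) * qint (n + 1 - m))))
          * (qz (-(2 * c) + 2 * l + 5) * qdiff2 (l + 2) * qdiff2 c)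
        - ((qz (-1 - n + 2 * m) * qint (n + 1 - m)) * (qz (-3 - n + 2 * m) * qint (n + 2 - m)))
          * (qz (-(4 * c) + 4 * l + 14) * qdiff2 c * qdiff2 (c - 1)) := by
  subst hn
  have hq : qz 1 - qz (-1) ≠ 0 := by exact_mod_cast qz_sub_qz_neg_ne_zero one_ne_zero
  have hX := RatFunc.X_ne_zero (K := ℚ)
  have hm := qz_ne_zero m
  have hl := qz_ne_zero l
  have hc := qz_ne_zero c
  simp only [qz_neg, qz_one] at hq
  simp only [qint, qdiff2, qz_neg, qz_ofNat_mul, qz_add, qz_sub, qz_ofNat, qz_one]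
  generalize qz m = M at *
  generalize qz l = L at *
  generalize qz c = C at *
  generalize (RatFunc.X : F) = q at *
  generalize hd : q - q⁻¹ = d at *
  field_simp
  ring

lemma sum_range_shift {M : Type*} [AddCommMonoid M] (N : ℕ) (f : ℕ → M) (h : f 0 = 0) :
    ∑ c ∈ Finset.range N, f (c + 1) = ∑ c ∈ Finset.range (N + 1), f c := by
  rw [Finset.sum_range_succ', h, add_zero]

/-- The expansion of `v_{e + 2j}` in terms of a family `U` satisfying the recurrence of the
idivided powers applied to `v₀`. -/
theorem vz_eq_sum_invCoeff (n : ℕ) (e : ℤ) (he : e = 0 ∨ e = 1) (U : ℤ → V n)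
    (hU : ∀ i, Bop n (Bop n (U i)) = (qint (e + 2 * i + 1) * qint (e + 2 * i + 2)) • U (i + 1)
      + qint (e + 2 * i + 1) ^ 2 • U i)
    (hneg : ∀ i < 0, U i = 0) (h0 : U 0 = vz n e) (j : ℕ) :
    ∀ l : ℕ, (n : ℤ) = e + 1 + 2 * (l + j) →
      (∀ N, j ≤ N → vz n (e + 2 * j - 2)
        = ∑ c ∈ Finset.range N, invCoeff (l + 1) c • U (j - 1 - c)) ∧
      (∀ N, j + 1 ≤ N → vz n (e + 2 * j)
        = ∑ c ∈ Finset.range N, invCoeff l c • U (j - c)) := by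
  induction j with
  | zero =>
    intro l _
    refine ⟨fun N _ => ?_, fun N hN => ?_⟩
    · rw [vz_eq_zero (by omega)]
      exact (Finset.sum_eq_zero fun c _ => by rw [hneg _ (by omega), smul_zero]).symm
    · obtain ⟨N, rfl⟩ := Nat.exists_eq_add_of_le' hN
      rw [Finset.sum_range_succ', Finset.sum_eq_zero fun c _ => by
        rw [hneg _ (by push_cast; omega), smul_zero]]
      simp [invCoeff_zero, h0]
  | succ j ih =>
    intro l hl
    obtain ⟨ih1, ih2⟩ := ih (l + 1) (by push_cast at hl ⊢; linarith)
    refine ⟨fun N hN => ?_, fun N hN => ?_⟩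
    · have := ih2 N hN
      push_cast
      rw [show e + 2 * ((j : ℤ) + 1) - 2 = e + 2 * j by ring, this]
      simp only [add_sub_cancel_right]
    · obtain ⟨N, rfl⟩ := Nat.exists_eq_add_of_le' (show 2 ≤ N by omega)
      have hA : vz n (e + 2 * j) = ∑ c ∈ Finset.range (N + 2),
          -(invCoeffFactor l c * (qz (-(2 * c) + 2 * l + 5) * qdiff2 (l + 2) * qdiff2 c))
            • U (j + 1 - c) := by
        rw [← sum_range_shift _ _ (by simp [qdiff2_zero]), ih2 (N + 1) (by omega)]
        refine Finset.sum_congr rfl fun c _ => ?_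
        rw [invCoeff_pred_right]
        push_cast
        rw [add_sub_add_right_eq_sub]
      have hA' : ∑ c ∈ Finset.range (N + 2),
            (invCoeff (l + 1) c * qint (e + 2 * (j - c) + 1) ^ 2) • U (j - c)
          = ∑ c ∈ Finset.range (N + 2),
            -(invCoeffFactor l c * (qz (-(2 * c) + 2 * l + 5) * qdiff2 (l + 2) * qdiff2 c)
              * qint (e + 2 * (j + 1 - c) + 1) ^ 2) • U (j + 1 - c) := by
        rw [Finset.sum_range_succ, hneg _ (by push_cast; omega), smul_zero, add_zero,
          ← sum_range_shift (N + 1) _ (by simp [qdiff2_zero])]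
        refine Finset.sum_congr rfl fun c _ => ?_
        rw [invCoeff_pred_right]
        push_cast
        rw [add_sub_add_right_eq_sub, neg_mul]
      have hC : vz n (e + 2 * j - 2) = ∑ c ∈ Finset.range (N + 2),
          (invCoeffFactor l c * (qz (-(4 * c) + 4 * l + 14) * qdiff2 c * qdiff2 (c - 1)))
            • U (j + 1 - c) := by
        rw [← sum_range_shift _ _ (by simp [qdiff2_zero]),
          ← sum_range_shift _ _ (by simp [qdiff2_zero]), ih1 N (by omega)]
        refine Finset.sum_congr rfl fun c _ => ?_
        rw [invCoeff_pred_pred_right]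
        push_cast
        have e1 : (c : ℤ) + 1 + 1 = c + 2 := by ring
        have e2 : (c : ℤ) + 2 - 1 = c + 1 := by ring
        have e3 : (j : ℤ) + 1 - (c + 2) = j - 1 - c := by ring
        rw [e1, e2, e3]
      have hB : Bop n (Bop n (vz n (e + 2 * j))) = ∑ c ∈ Finset.range (N + 2),
            (invCoeff (l + 1) c * (qint (e + 2 * (j - c) + 1) * qint (e + 2 * (j - c) + 2)))
              • U (j + 1 - c)
          + ∑ c ∈ Finset.range (N + 2),
            (invCoeff (l + 1) c * qint (e + 2 * (j - c) + 1) ^ 2) • U (j - c) := by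
        rw [ih2 (N + 2) (by omega), map_sum, map_sum, ← Finset.sum_add_distrib]
        refine Finset.sum_congr rfl fun c _ => ?_
        rw [map_smul, map_smul, hU, smul_add, smul_smul, smul_smul, sub_add_eq_add_sub]
      have hsq := Bop_sq_vz n (e + 2 * j)
      rw [hB, hA', ← sub_eq_iff_eq_add, ← sub_eq_iff_eq_add] at hsq
      have hne : qint (e + 2 * j + 1) * qint (e + 2 * j + 2) ≠ 0 := by
        have (k : ℤ) (hk : 0 < k) : qint k ≠ 0 := by
          lift k to ℕ using hk.le
          exact qint_natCast_ne_zero (by omega)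
        exact mul_ne_zero (this _ (by omega)) (this _ (by omega))
      refine smul_right_injective _ hne ?_
      beta_reduce
      rw [show e + 2 * ((j + 1 : ℕ) : ℤ) = e + 2 * j + 2 by push_cast; ring, ← hsq, hA, hC]
      simp only [Finset.smul_sum, smul_smul]
      rw [← Finset.sum_add_distrib, ← Finset.sum_sub_distrib, ← Finset.sum_sub_distrib]
      refine Finset.sum_congr rfl fun c _ => ?_
      rw [← add_smul, ← sub_smul, ← sub_smul, invCoeff_succ_left, invCoeff_eq l]
      push_cast
      congr 1
      have key := qdiff2_three_term (e + 2 * j) l c n (by push_cast at hl; linarith)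
      have e1 : e + 2 * (j : ℤ) - 2 * c = e + 2 * (j - c) := by ring
      have e2 : e + 2 * ((j : ℤ) - c) + 3 = e + 2 * (j + 1 - c) + 1 := by ring
      rw [e1, e2] at key
      linear_combination (-invCoeffFactor l c) * key

/-- The vectors `v_{n - 1 - 2l}` in terms of the idivided powers applied to `v₀`. -/
theorem vz_sub_eq_sum_invCoeff (n : ℕ) (hn : 1 ≤ n) (l : ℕ) (hl : 2 * l ≤ n - 1) :
    vz n ((n - 1 - 2 * l : ℕ) : ℤ)
      = ∑ c ∈ Finset.range ((n - 1) / 2 - l + 1),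
          invCoeff l c •
            (idp (Bop n) ((n : ℕ) : ZMod 2) ((n : ℤ) - 1 - 2 * l - 2 * c)) (vb n 0) := by
  have h0 : vb n 0 = vz n 0 := (vz_eq_vb n 0).symm
  rw [h0]
  have hsq (x : Module.End F (V n)) (v : V n) : Bop n (Bop n (x v)) = (Bop n ^ 2 * x) v := by
    rw [sq]; rfl
  rcases Nat.even_or_odd' n with ⟨k, hk | hk⟩
  · have hp : ((n : ℕ) : ZMod 2) = 0 := by
      rw [hk, ZMod.natCast_eq_zero_iff]; exact dvd_mul_right 2 k
    obtain ⟨j, hj⟩ : ∃ j, k = l + j + 1 := ⟨k - l - 1, by omega⟩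
    have h := (vz_eq_sum_invCoeff n 1 (Or.inr rfl)
      (fun i => idp (Bop n) 0 (2 * i + 1) (vz n 0)) (fun i => ?_) (fun i hi => ?_) ?_ j l
      (by omega)).2 (j + 1) le_rfl
    · rw [hp, show (n - 1) / 2 - l + 1 = j + 1 by omega,
        show ((n - 1 - 2 * l : ℕ) : ℤ) = 1 + 2 * j by omega, h]
      refine Finset.sum_congr rfl fun c _ => ?_
      rw [show (n : ℤ) - 1 - 2 * l - 2 * c = 2 * (j - c) + 1 by omega]
    · beta_reduce
      rw [hsq, sq_mul_idp_zero_odd, show 1 + 2 * i + 1 = 2 * i + 2 by ring,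
        show 1 + 2 * i + 2 = 2 * i + 3 by ring]
      rfl
    · beta_reduce
      rw [idp_of_neg _ _ (by omega)]
      rfl
    · have := idp_zero_odd (Bop n) 0
      simp only [Nat.cast_zero, mul_zero, List.range_zero, List.map_nil, List.prod_nil,
        mul_one] at this
      simp only [mul_zero]
      rw [this, LinearMap.smul_apply, Bop_vz, vz_eq_zero (by omega : (0 : ℤ) - 1 < 0 ∨ _)]
      simp [qfact, qint_one]
  · have hp : ((n : ℕ) : ZMod 2) = 1 := by
      rw [hk, Nat.cast_add, (ZMod.natCast_eq_zero_iff (2 * k) 2).2 (dvd_mul_right 2 k), zero_add,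
        Nat.cast_one]
    obtain ⟨j, hj⟩ : ∃ j, k = l + j := ⟨k - l, by omega⟩
    have h := (vz_eq_sum_invCoeff n 0 (Or.inl rfl)
      (fun i => idp (Bop n) 1 (2 * i) (vz n 0)) (fun i => ?_) (fun i hi => ?_) ?_ j l
      (by omega)).2 (j + 1) le_rfl
    · rw [hp, show (n - 1) / 2 - l + 1 = j + 1 by omega,
        show ((n - 1 - 2 * l : ℕ) : ℤ) = 0 + 2 * j by omega, h]
      refine Finset.sum_congr rfl fun c _ => ?_
      rw [show (n : ℤ) - 1 - 2 * l - 2 * c = 2 * (j - c) by omega]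
    · beta_reduce
      rw [hsq, sq_mul_idp_one_even, zero_add]
      rfl
    · beta_reduce
      rw [idp_of_neg _ _ (by omega)]
      rfl
    · simp [idp]

end Lnmod

/-- Proposition 3.9 (`prop:inverse`, odd case) of the paper: on `L(n)` with `n ≥ 1` and
`p = n mod 2`, for `0 ≤ 2ℓ ≤ n−1`:
`v_{n−1−2ℓ} = Σ_{c=0}^{⌊(n−1)/2⌋−ℓ} (−1)^c q^{−(2ℓ+3)c} ⌊ℓ+c ¦ c⌋_{q²} · B^{(n−1−2ℓ−2c)}_{p̄}(v₀)`. -/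
theorem statement11 (n : ℕ) (hn : 1 ≤ n) (l : ℕ) (hl : 2 * l ≤ n - 1) :
    vb n ⟨n - 1 - 2 * l, by omega⟩
      = ∑ c ∈ Finset.range ((n - 1) / 2 - l + 1),
          ((-1 : F) ^ c * qz (-((2 * (l : ℤ) + 3) * c)) * qbinom2 ((l : ℤ) + c) c) •
            (idp (Bop n) ((n : ℕ) : ZMod 2) ((n : ℤ) - 1 - 2 * l - 2 * c)) (vb n 0) := by
  rw [← vz_eq_vb]
  exact vz_sub_eq_sum_invCoeff n hn l hl
end
end
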